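/- arXiv:2510.05550 — 8 statements merged into one kernel-verified Lean document; each statement's English description precedes it below -/
import Mathlib

section
/- Let G be a nonempty subset of D that is c-path bounded and countable. Then G has a c-antiderivative. -/
open scoped BigOperators

namespace Paper

variable {X Y : Type*}

/-- The domain of the cost `c`, i.e. the set where `c` is finite. -/
def Dom (c : X × Y → EReal) : Set (X × Y) := {p | c p < ⊤}

/-- `z` is a path in `G` from `p` to `q` (with `N` steps). -/
def IsPath (c : X × Y → EReal) (G : Set (X × Y)) (p q : X × Y)
    (N : ℕ) (z : Fin (N + 1) → X × Y) : Prop :=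
  (∀ k, z k ∈ G) ∧ z 0 = p ∧ z (Fin.last N) = q ∧
    ∀ k : Fin N, c ((z k.succ).1, (z k.castSucc).2) < ⊤

/-- The inner variation `∑_{k=1}^N (c(x_k,y_k) − c(x_{k+1},y_k))` along a path; all the
terms involved are finite for a path in `G ⊆ Dom c`, so the real-valued sum is faithful. -/
noncomputable def pathSum (c : X × Y → EReal) {N : ℕ} (z : Fin (N + 1) → X × Y) : ℝ :=
  ∑ k : Fin N, ((c (z k.castSucc)).toReal - (c ((z k.succ).1, (z k.castSucc).2)).toReal)

/-- The maximal inner variation `F_G(p,q)`, with the convention `sSup ∅ = ⊥ = −∞`. -/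
noncomputable def innerVar (c : X × Y → EReal) (G : Set (X × Y)) (p q : X × Y) : EReal :=
  sSup {s : EReal | ∃ (N : ℕ) (z : Fin (N + 1) → X × Y),
    IsPath c G p q N z ∧ s = ((pathSum c z : ℝ) : EReal)}

/-- `G` is `c`-path bounded. -/
def PathBounded (c : X × Y → EReal) (G : Set (X × Y)) : Prop :=
  ∀ p ∈ G, ∀ q ∈ G, innerVar c G p q < ⊤

/-- `G` is `c`-cyclically monotone. -/
def CyclicallyMonotone (c : X × Y → EReal) (G : Set (X × Y)) : Prop :=
  ∀ p ∈ G, innerVar c G p p ≤ 0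

/-- `f` is a `c`-antiderivative of `G`:
`c(x,y) − c(u,y) ≤ f(x,y) − f(u,v)` in `[−∞,+∞]` for all `(x,y),(u,v) ∈ G`. -/
def IsAntideriv (c : X × Y → EReal) (G : Set (X × Y)) (f : X × Y → ℝ) : Prop :=
  ∀ p ∈ G, ∀ q ∈ G, c p - c (q.1, p.2) ≤ (f p : EReal) - (f q : EReal)

/-- `p` and `q` are strongly connected (mutually reachable by paths) in `G`. -/
def StronglyConn (c : X × Y → EReal) (G : Set (X × Y)) (p q : X × Y) : Prop :=
  (∃ N z, IsPath c G p q N z) ∧ (∃ N z, IsPath c G q p N z)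

/-- A family of constraints `s ≤ g i - g j`, closed under composition and consistent, can be
solved at one more index once it is solved at all smaller ones. -/
lemma exists_extend {R : ℕ → ℕ → ℝ → Prop}
    (hcomp : ∀ i j k s t, R i j s → R j k t → R i k (s + t))
    (hbdd : ∀ i j, BddAbove {s | R i j s}) (hcyc : ∀ i s, R i i s → s ≤ 0)
    (n : ℕ) (g : ℕ → ℝ) (hg : ∀ i < n, ∀ j < n, ∀ s, R i j s → s ≤ g i - g j) :
    ∃ x, ∀ i < n + 1, ∀ j < n + 1, ∀ s, R i j s →
      s ≤ Function.update g n x i - Function.update g n x j := by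
  choose B hB using hbdd
  have key : ∃ x, (∀ j < n, ∀ s, R n j s → s + g j ≤ x) ∧
      ∀ j < n, ∀ s, R j n s → x ≤ g j - s := by
    by_cases hL : ∃ j < n, ∃ s, R n j s
    · obtain ⟨j₀, hj₀, s₀, hs₀⟩ := hL
      obtain ⟨M, hM⟩ := ((Finset.range n).image fun j => B n j + g j).bddAbove
      have hbd : BddAbove {y | ∃ j < n, ∃ s, R n j s ∧ s + g j = y} := by
        refine ⟨M, ?_⟩
        rintro _ ⟨j, hj, s, hs, rfl⟩
        have h₁ : s ≤ B n j := hB n j hs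
        have h₂ : B n j + g j ≤ M := hM (by
          simp only [Finset.coe_image, Set.mem_image, Finset.coe_range, Set.mem_Iio]
          exact ⟨j, hj, rfl⟩)
        linarith
      refine ⟨sSup {y | ∃ j < n, ∃ s, R n j s ∧ s + g j = y},
        fun j hj s hs => le_csSup hbd ⟨j, hj, s, hs, rfl⟩, fun k hk t ht => ?_⟩
      refine csSup_le ⟨_, j₀, hj₀, s₀, hs₀, rfl⟩ ?_
      rintro _ ⟨j, hj, s, hs, rfl⟩
      have := hg k hk j hj _ (hcomp _ _ _ _ _ ht hs)
      linarith
    · push Not at hL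
      obtain ⟨m, hm⟩ := ((Finset.range n).image fun j => g j - B j n).bddBelow
      refine ⟨m, fun j hj s hs => absurd hs (hL j hj s), fun j hj s hs => ?_⟩
      have h₁ : s ≤ B j n := hB j n hs
      have h₂ : m ≤ g j - B j n := hm (by
        simp only [Finset.coe_image, Set.mem_image, Finset.coe_range, Set.mem_Iio]
        exact ⟨j, hj, rfl⟩)
      linarith
  obtain ⟨x, hlow, hup⟩ := key
  refine ⟨x, fun i hi j hj s hs => ?_⟩
  rcases Nat.lt_succ_iff_lt_or_eq.mp hi with hi | rfl <;>
    rcases Nat.lt_succ_iff_lt_or_eq.mp hj with hj | rfl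
  · rw [Function.update_of_ne hi.ne, Function.update_of_ne hj.ne]
    exact hg i hi j hj s hs
  · rw [Function.update_of_ne hi.ne, Function.update_self]
    linarith [hup i hi s hs]
  · rw [Function.update_of_ne hj.ne, Function.update_self]
    linarith [hlow j hj s hs]
  · simpa using hcyc _ s hs

/-- A consistent family of constraints `s ≤ g i - g j`, closed under composition, has a
solution on `ℕ`. -/
lemma exists_potential_nat {R : ℕ → ℕ → ℝ → Prop}
    (hcomp : ∀ i j k s t, R i j s → R j k t → R i k (s + t))
    (hbdd : ∀ i j, BddAbove {s | R i j s}) (hcyc : ∀ i s, R i i s → s ≤ 0) :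
    ∃ g : ℕ → ℝ, ∀ i j s, R i j s → s ≤ g i - g j := by
  choose! h hh using exists_extend hcomp hbdd hcyc
  let a : ℕ → ℕ → ℝ := fun n => Nat.rec 0 (fun n g => Function.update g n (h n g)) n
  have ha : ∀ n, a (n + 1) = Function.update (a n) n (h n (a n)) := fun _ => rfl
  have hgood : ∀ n, ∀ i < n, ∀ j < n, ∀ s, R i j s → s ≤ a n i - a n j := by
    intro n
    induction n with
    | zero => intro i hi; omega
    | succ n ih => rw [ha]; exact hh n (a n) ih
  have hstable : ∀ i n, i < n → a n i = a (i + 1) i := by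
    intro i n hn
    induction n, hn using Nat.le_induction with
    | base => rfl
    | succ n hn ih =>
      rw [ha, Function.update_of_ne (by omega), ih]
  refine ⟨fun i => a (i + 1) i, fun i j s hs => ?_⟩
  have := hgood (i + j + 1) i (by omega) j (by omega) s hs
  rwa [hstable i (i + j + 1) (by omega), hstable j (i + j + 1) (by omega)] at this

/-- A consistent family of constraints `s ≤ f p - f q`, closed under composition, has a
solution on any countable type. -/
lemma exists_potential {V : Type*} [Countable V] {R : V → V → ℝ → Prop}
    (hcomp : ∀ p q r s t, R p q s → R q r t → R p r (s + t))
    (hbdd : ∀ p q, BddAbove {s | R p q s}) (hcyc : ∀ p s, R p p s → s ≤ 0) :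
    ∃ f : V → ℝ, ∀ p q s, R p q s → s ≤ f p - f q := by
  cases isEmpty_or_nonempty V
  · exact ⟨fun _ => 0, fun p => isEmptyElim p⟩
  obtain ⟨e, he⟩ := exists_surjective_nat V
  obtain ⟨g, hg⟩ := exists_potential_nat (R := fun i j => R (e i) (e j))
    (fun _ _ _ => hcomp _ _ _) (fun _ _ => hbdd _ _) (fun _ => hcyc _)
  refine ⟨fun p => g (Function.surjInv he p), fun p q s hs => hg _ _ s ?_⟩
  rwa [Function.surjInv_eq he, Function.surjInv_eq he]

/-- `Reach c G p q s` says that some path in `G` from `p` to `q` has inner variation `s`. -/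
inductive Reach (c : X × Y → EReal) (G : Set (X × Y)) : G → G → ℝ → Prop
  | refl (p : G) : Reach c G p p 0
  | step (p q r : G) (s : ℝ) (hpq : c (q.1.1, p.1.2) < ⊤) (hqr : Reach c G q r s) :
      Reach c G p r (((c p.1).toReal - (c (q.1.1, p.1.2)).toReal) + s)

lemma Reach.trans {c : X × Y → EReal} {G : Set (X × Y)} {p q r : G} {s t : ℝ}
    (h₁ : Reach c G p q s) (h₂ : Reach c G q r t) : Reach c G p r (s + t) := by
  induction h₁ with
  | refl p => simpa using h₂
  | step p q r s hpq _ ih =>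
    rw [add_assoc]
    exact .step _ _ _ _ hpq (ih h₂)

lemma Reach.exists_isPath {c : X × Y → EReal} {G : Set (X × Y)} {p q : G} {s : ℝ}
    (h : Reach c G p q s) :
    ∃ (N : ℕ) (z : Fin (N + 1) → X × Y), IsPath c G p q N z ∧ s = pathSum c z := by
  induction h with
  | refl p => exact ⟨0, fun _ => p, ⟨fun _ => p.2, rfl, rfl, fun k => k.elim0⟩, by simp [pathSum]⟩
  | step p q r s hpq _ ih =>
    obtain ⟨N, z, ⟨hzG, hz0, hzN, hz⟩, rfl⟩ := ih
    refine ⟨N + 1, Fin.cons p.1 z, ⟨?_, rfl, ?_, ?_⟩, ?_⟩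
    · exact Fin.cases p.2 hzG
    · rw [← Fin.succ_last, Fin.cons_succ, hzN]
    · refine Fin.cases ?_ fun k => ?_
      · simpa [hz0] using hpq
      · simpa only [Fin.castSucc_succ, Fin.cons_succ] using hz k
    · rw [pathSum, pathSum, Fin.sum_univ_succ]
      simp only [Fin.castSucc_succ, Fin.cons_succ, Fin.castSucc_zero, Fin.cons_zero, hz0]

lemma PathBounded.bddAbove_reach {c : X × Y → EReal} {G : Set (X × Y)}
    (h : PathBounded c G) (p q : G) : BddAbove {s | Reach c G p q s} := by
  refine ⟨(innerVar c G p q).toReal, fun s hs => ?_⟩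
  obtain ⟨N, z, hz, rfl⟩ := Reach.exists_isPath hs
  have hle : ((pathSum c z : ℝ) : EReal) ≤ innerVar c G p q := le_sSup ⟨N, z, hz, rfl⟩
  exact_mod_cast hle.trans (EReal.le_coe_toReal (h p p.2 q q.2).ne)

lemma PathBounded.reach_self_nonpos {c : X × Y → EReal} {G : Set (X × Y)}
    (h : PathBounded c G) (p : G) (s : ℝ) (hs : Reach c G p p s) : s ≤ 0 := by
  obtain ⟨B, hB⟩ := h.bddAbove_reach p p
  have hmul : ∀ n : ℕ, Reach c G p p (n * s) := by
    intro n
    induction n with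
    | zero => simpa using Reach.refl p
    | succ n ih =>
      push_cast
      rw [add_mul, one_mul]
      exact ih.trans hs
  by_contra! hpos
  obtain ⟨n, hn⟩ := exists_nat_gt (B / s)
  rw [div_lt_iff₀ hpos] at hn
  exact absurd (hB (hmul n)) (not_le.mpr hn)

/-- a nonempty countable `c`-path bounded set has a `c`-antiderivative. -/
theorem antideriv_of_countable (c : X × Y → EReal) (hbot : ∀ p, c p ≠ ⊥)
    (G : Set (X × Y)) (hne : G.Nonempty) (hGD : G ⊆ Dom c)
    (hpb : PathBounded c G) (hcount : G.Countable) :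
    ∃ f : X × Y → ℝ, IsAntideriv c G f := by
  classical
  have := hcount.to_subtype
  obtain ⟨f, hf⟩ := exists_potential (R := Reach c G) (fun _ _ _ _ _ => Reach.trans)
    hpb.bddAbove_reach hpb.reach_self_nonpos
  refine ⟨fun p => if hp : p ∈ G then f ⟨p, hp⟩ else 0, fun p hp q hq => ?_⟩
  simp only [hp, hq, dif_pos]
  have hp_top : c p < ⊤ := hGD hp
  rcases eq_or_ne (c (q.1, p.2)) ⊤ with htop | htop
  · simp [htop]
  · have key := hf ⟨p, hp⟩ ⟨q, hq⟩ _ (.step _ _ _ _ htop.lt_top (.refl _))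
    rw [← EReal.coe_toReal hp_top.ne (hbot p), ← EReal.coe_toReal htop (hbot _)]
    rw [add_zero] at key
    exact_mod_cast key

end Paper
end

section
/- Let G be a nonempty c-path bounded subset of D and let Ω be a nonempty subset of G. Define f : G → [−∞,+∞] by f(x,y) := sup over (x_e,y_e) ∈ Ω of F_G((x,y),(x_e,y_e)). If f(x,y) ∈ ℝ for every (x,y) ∈ G, then f is a c-antiderivative of G. -/
open scoped BigOperators

namespace Paper

variable {X Y : Type*}

theorem IsPath.cons {c : X × Y → EReal} {G : Set (X × Y)} {p q e : X × Y} {N : ℕ}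
    {z : Fin (N + 1) → X × Y} (hz : IsPath c G q e N z) (hp : p ∈ G)
    (hpq : c (q.1, p.2) < ⊤) :
    IsPath c G p e (N + 1) (Fin.cons p z : Fin (N + 1 + 1) → X × Y) := by
  obtain ⟨hG, h0, hl, hc⟩ := hz
  refine ⟨?_, rfl, ?_, ?_⟩
  · intro k
    refine Fin.cases ?_ (fun i => ?_) k
    · simpa using hp
    · simpa using hG i
  · rw [← Fin.succ_last, Fin.cons_succ, hl]
  · intro k
    refine Fin.cases ?_ (fun i => ?_) k
    · simpa [h0] using hpq
    · rw [Fin.castSucc_succ, Fin.cons_succ, Fin.cons_succ]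
      exact hc i

theorem pathSum_cons (c : X × Y → EReal) {N : ℕ} (p : X × Y) (z : Fin (N + 1) → X × Y) :
    pathSum c (Fin.cons p z : Fin (N + 1 + 1) → X × Y) =
      (c p).toReal - (c ((z 0).1, p.2)).toReal + pathSum c z := by
  simp only [pathSum]
  rw [Fin.sum_univ_succ]
  simp only [Fin.castSucc_zero, Fin.cons_zero, Fin.cons_succ, Fin.castSucc_succ]

/-- Prepending a step from `p` to `q` bounds `F_G(q,e)` in terms of `F_G(p,e)`. -/
theorem innerVar_le_of_step {c : X × Y → EReal} {G : Set (X × Y)} {p q e : X × Y} {r : ℝ}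
    (hp : p ∈ G) (hpq : c (q.1, p.2) < ⊤) (hr : innerVar c G p e ≤ (r : EReal)) :
    innerVar c G q e ≤
      ((r - ((c p).toReal - (c (q.1, p.2)).toReal) : ℝ) : EReal) := by
  refine sSup_le ?_
  rintro _ ⟨N, z, hz, rfl⟩
  have h := (le_sSup ⟨N + 1, _, hz.cons hp hpq, rfl⟩ : _ ≤ innerVar c G p e).trans hr
  rw [EReal.coe_le_coe_iff, pathSum_cons, hz.2.1] at h
  rw [EReal.coe_le_coe_iff]
  linarith

/-- if `f(p) = sup_{q ∈ Ω} F_G(p,q)` is real-valued on `G`, then it is a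
`c`-antiderivative of `G`. -/
theorem antideriv_of_sup_real (c : X × Y → EReal) (hbot : ∀ p, c p ≠ ⊥)
    (G : Set (X × Y)) (hne : G.Nonempty) (hGD : G ⊆ Dom c)
    (hpb : PathBounded c G)
    (Ω : Set (X × Y)) (hΩne : Ω.Nonempty) (hΩG : Ω ⊆ G)
    (hreal : ∀ p ∈ G, ∃ r : ℝ, (⨆ q ∈ Ω, innerVar c G p q) = (r : EReal)) :
    IsAntideriv c G (fun p => (⨆ q ∈ Ω, innerVar c G p q).toReal) := by
  intro p hp q hq
  obtain ⟨r, hr⟩ := hreal p hp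
  obtain ⟨t, ht⟩ := hreal q hq
  simp only [hr, ht, EReal.toReal_coe]
  rcases eq_or_ne (c (q.1, p.2)) ⊤ with htop | htop
  · rw [htop, EReal.sub_top]
    exact bot_le
  · have hle : (t : EReal) ≤
        ((r - ((c p).toReal - (c (q.1, p.2)).toReal) : ℝ) : EReal) := by
      rw [← ht]
      refine iSup₂_le fun e he => innerVar_le_of_step hp htop.lt_top ?_
      rw [← hr]
      exact le_iSup₂ (f := fun e (_ : e ∈ Ω) => innerVar c G p e) e he
    rw [← EReal.coe_toReal (hGD hp).ne (hbot p), ← EReal.coe_toReal htop (hbot _),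
      ← EReal.coe_sub, ← EReal.coe_sub, EReal.coe_le_coe_iff]
    rw [EReal.coe_le_coe_iff] at hle
    linarith

end Paper
end

section
/- Let G be a nonempty c-path bounded subset of D and let A be a nonempty subset of G. Define f : G → [−∞,+∞] by f(x,y) := − sup over (x_s,y_s) ∈ A of F_G((x_s,y_s),(x,y)). If f(x,y) ∈ ℝ for every (x,y) ∈ G, then f is a c-antiderivative of G. -/
open scoped BigOperators

namespace Paper

variable {X Y : Type*}

/-- A path in `G` can be prolonged by a point `q` of `G` for which the new step is finite. -/
theorem IsPath.snoc {c : X × Y → EReal} {G : Set (X × Y)} {a p q : X × Y} {N : ℕ}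
    {z : Fin (N + 1) → X × Y} (hz : IsPath c G a p N z) (hq : q ∈ G) (hc : c (q.1, p.2) < ⊤) :
    IsPath c G a q (N + 1) (Fin.snoc z q : Fin (N + 2) → X × Y) := by
  obtain ⟨hG, h0, hN, hstep⟩ := hz
  refine ⟨fun k => ?_, ?_, Fin.snoc_last _ _, fun k => ?_⟩
  · induction k using Fin.lastCases with
    | last => simpa using hq
    | cast k => simpa using hG k
  · rw [← Fin.castSucc_zero, Fin.snoc_castSucc (α := fun _ => X × Y), h0]
  · rw [Fin.snoc_castSucc (α := fun _ => X × Y)]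
    induction k using Fin.lastCases with
    | last => simpa [hN] using hc
    | cast k => rw [Fin.succ_castSucc, Fin.snoc_castSucc (α := fun _ => X × Y)]; exact hstep k

theorem pathSum_snoc (c : X × Y → EReal) {N : ℕ} (z : Fin (N + 1) → X × Y) (q : X × Y) :
    pathSum c (Fin.snoc z q : Fin (N + 2) → X × Y) = pathSum c z +
      ((c (z (Fin.last N))).toReal - (c (q.1, (z (Fin.last N)).2)).toReal) := by
  simp only [pathSum, Fin.sum_univ_castSucc (n := N), Fin.succ_castSucc,
    Fin.snoc_castSucc (α := fun _ => X × Y), Fin.succ_last, Fin.snoc_last (α := fun _ => X × Y)]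

/-- The upper bounds of the inner variations ending at `q` control those ending at `p`. -/
theorem innerVar_le_sub {c : X × Y → EReal} {G : Set (X × Y)} {a p q : X × Y} {s : ℝ}
    (hq : q ∈ G) (hc : c (q.1, p.2) < ⊤) (hs : innerVar c G a q ≤ s) :
    innerVar c G a p ≤ ((s - ((c p).toReal - (c (q.1, p.2)).toReal) : ℝ) : EReal) := by
  refine sSup_le ?_
  rintro _ ⟨N, z, hz, rfl⟩
  have h := (le_sSup ⟨N + 1, _, hz.snoc hq hc, rfl⟩ : _ ≤ innerVar c G a q).trans hs
  rw [pathSum_snoc, hz.2.2.1, EReal.coe_le_coe_iff] at h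
  exact EReal.coe_le_coe_iff.2 (by linarith)

/-- if `f(p) = − sup_{q ∈ A} F_G(q,p)` is real-valued on `G`, then it is a
`c`-antiderivative of `G`. -/
theorem antideriv_of_neg_sup_real (c : X × Y → EReal) (hbot : ∀ p, c p ≠ ⊥)
    (G : Set (X × Y)) (hne : G.Nonempty) (hGD : G ⊆ Dom c)
    (hpb : PathBounded c G)
    (A : Set (X × Y)) (hAne : A.Nonempty) (hAG : A ⊆ G)
    (hreal : ∀ p ∈ G, ∃ r : ℝ, (-(⨆ q ∈ A, innerVar c G q p)) = (r : EReal)) :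
    IsAntideriv c G (fun p => (-(⨆ q ∈ A, innerVar c G q p)).toReal) := by
  intro p hp q hq
  obtain ⟨r, hr⟩ := hreal p hp
  obtain ⟨t, ht⟩ := hreal q hq
  simp only [hr, ht, EReal.toReal_coe]
  have hp_top : c p ≠ ⊤ := (hGD hp).ne
  rcases eq_or_ne (c (q.1, p.2)) ⊤ with htop | htop
  · rw [htop, EReal.sub_top]
    exact bot_le
  have hr' : (⨆ a ∈ A, innerVar c G a p) = ((-r : ℝ) : EReal) := by
    rw [← neg_neg (⨆ a ∈ A, innerVar c G a p), hr, EReal.coe_neg]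
  have ht' : (⨆ a ∈ A, innerVar c G a q) = ((-t : ℝ) : EReal) := by
    rw [← neg_neg (⨆ a ∈ A, innerVar c G a q), ht, EReal.coe_neg]
  have hle : (⨆ a ∈ A, innerVar c G a p) ≤
      ((-t - ((c p).toReal - (c (q.1, p.2)).toReal) : ℝ) : EReal) :=
    iSup₂_le fun a ha => innerVar_le_sub hq htop.lt_top
      ((le_iSup₂ (f := fun a _ => innerVar c G a q) a ha).trans ht'.le)
  rw [hr', EReal.coe_le_coe_iff] at hle
  rw [← EReal.coe_toReal hp_top (hbot p), ← EReal.coe_toReal htop (hbot _), ← EReal.coe_sub,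
    ← EReal.coe_sub, EReal.coe_le_coe_iff]
  linarith

end Paper
end

section
/- Let G be a nonempty c-path bounded subset of D. Suppose there exists (u,v) ∈ G such that the set {y ∈ Y : there exists x ∈ X with (x,y) ∈ G and c(u,y) = +∞} is finite. Then G has a c-antiderivative. -/
open scoped BigOperators

namespace Paper

variable {X Y : Type*}

/-- Prepending an edge `p → q` to paths starting at `q` gives a triangle inequality. -/
theorem innerVar_add_le (c : X × Y → EReal) (G : Set (X × Y)) {p q t : X × Y}
    (hp : p ∈ G) (hpq : c (q.1, p.2) < ⊤) :
    innerVar c G q t ≤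
      innerVar c G p t - (((c p).toReal - (c (q.1, p.2)).toReal : ℝ) : EReal) := by
  refine sSup_le ?_
  rintro _ ⟨N, z, ⟨hzG, hz0, hzl, hze⟩, rfl⟩
  rw [EReal.le_sub_iff_add_le (Or.inl (EReal.coe_ne_bot _)) (Or.inl (EReal.coe_ne_top _)),
    ← EReal.coe_add]
  refine le_sSup ⟨N + 1, Fin.cons p z, ⟨?_, rfl, ?_, ?_⟩, ?_⟩
  · exact Fin.cases hp hzG
  · rw [← Fin.succ_last, Fin.cons_succ, hzl]
  · refine Fin.cases ?_ fun k => ?_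
    · simpa [hz0] using hpq
    · simpa [← Fin.succ_castSucc] using hze k
  · rw [EReal.coe_eq_coe_iff, pathSum, pathSum, Fin.sum_univ_succ, add_comm]
    simp [hz0]

theorem coe_le_innerVar_of_edge (c : X × Y → EReal) (G : Set (X × Y)) {p t : X × Y}
    (hp : p ∈ G) (ht : t ∈ G) (hpt : c (t.1, p.2) < ⊤) :
    (((c p).toReal - (c (t.1, p.2)).toReal : ℝ) : EReal) ≤ innerVar c G p t := by
  refine le_sSup ⟨1, ![p, t], ⟨?_, rfl, rfl, ?_⟩, ?_⟩
  · exact Fin.cases hp fun _ => by simpa using ht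
  · intro k
    fin_cases k
    simpa using hpt
  · simp [pathSum]

/-- If every point of `G` has an edge into a finite set `T ⊆ G`, the maximum over `t ∈ T` of the
maximal inner variations to `t` is a `c`-antiderivative. -/
theorem isAntideriv_sup_innerVar (c : X × Y → EReal) (hbot : ∀ p, c p ≠ ⊥)
    (G : Set (X × Y)) (hGD : G ⊆ Dom c) (hpb : PathBounded c G)
    (T : Finset (X × Y)) (hTG : ↑T ⊆ G) (hT : ∀ p ∈ G, ∃ t ∈ T, c (t.1, p.2) < ⊤) :
    IsAntideriv c G fun p => (T.sup (innerVar c G p)).toReal := by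
  have htop : ∀ p ∈ G, T.sup (innerVar c G p) ≠ ⊤ := fun p hp =>
    ((Finset.sup_lt_iff bot_lt_top).2 fun t ht => hpb p hp t (hTG ht)).ne
  have hnbot : ∀ p ∈ G, T.sup (innerVar c G p) ≠ ⊥ := fun p hp => by
    obtain ⟨t, ht, hpt⟩ := hT p hp
    exact ne_bot_of_le_ne_bot (EReal.coe_ne_bot _)
      ((coe_le_innerVar_of_edge c G hp (hTG ht) hpt).trans
        (Finset.le_sup (f := innerVar c G p) ht))
  intro p hp q hq
  rw [EReal.coe_toReal (htop p hp) (hnbot p hp), EReal.coe_toReal (htop q hq) (hnbot q hq)]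
  by_cases hpq : c (q.1, p.2) = ⊤
  · simp [hpq]
  have hw : c p - c (q.1, p.2) = (((c p).toReal - (c (q.1, p.2)).toReal : ℝ) : EReal) := by
    rw [EReal.coe_sub, EReal.coe_toReal (hGD hp).ne (hbot p), EReal.coe_toReal hpq (hbot _)]
  have hle : T.sup (innerVar c G q) ≤ T.sup (innerVar c G p) - (c p - c (q.1, p.2)) := by
    rw [hw]
    exact Finset.sup_le fun t ht => (innerVar_add_le c G hp (lt_top_iff_ne_top.2 hpq)).trans
      (EReal.sub_le_sub (Finset.le_sup (f := innerVar c G p) ht) le_rfl)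
  rw [hw] at hle ⊢
  rw [EReal.le_sub_iff_add_le (Or.inl (EReal.coe_ne_bot _)) (Or.inl (EReal.coe_ne_top _))] at hle
  rw [EReal.le_sub_iff_add_le (Or.inl (hnbot q hq)) (Or.inl (htop q hq)), add_comm]
  exact hle

/-- if there is `(u,v) ∈ G` such that
`{y | ∃ x, (x,y) ∈ G ∧ c(u,y) = +∞}` is finite, then `G` has a `c`-antiderivative. -/
theorem antideriv_of_finite_blackhole (c : X × Y → EReal) (hbot : ∀ p, c p ≠ ⊥)
    (G : Set (X × Y)) (hne : G.Nonempty) (hGD : G ⊆ Dom c)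
    (hpb : PathBounded c G)
    (uv : X × Y) (huv : uv ∈ G)
    (hfin : {y : Y | (∃ x : X, (x, y) ∈ G) ∧ c (uv.1, y) = ⊤}.Finite) :
    ∃ f : X × Y → ℝ, IsAntideriv c G f := by
  classical
  obtain ⟨S, hSG, hS⟩ := Finset.subset_set_image_iff (s := G) (t := hfin.toFinset)
    (f := Prod.snd) |>.1 fun y hy => by
      obtain ⟨⟨x, hx⟩, -⟩ := hfin.mem_toFinset.1 hy
      exact ⟨(x, y), hx, rfl⟩
  refine ⟨_, isAntideriv_sup_innerVar c hbot G hGD hpb (insert uv S) ?_ fun p hp => ?_⟩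
  · rw [Finset.coe_insert]
    exact Set.insert_subset huv hSG
  by_cases hup : c (uv.1, p.2) = ⊤
  · have hpS : p.2 ∈ S.image Prod.snd := hS ▸ hfin.mem_toFinset.2 ⟨⟨p.1, hp⟩, hup⟩
    obtain ⟨t, ht, htp⟩ := Finset.mem_image.1 hpS
    exact ⟨t, Finset.mem_insert_of_mem ht, htp ▸ hGD (hSG ht)⟩
  · exact ⟨uv, Finset.mem_insert_self _ _, lt_top_iff_ne_top.2 hup⟩

end Paper
end

section
/- Suppose X and Y are metric spaces, the domain D of c is open in X × Y, and the restriction of c to D is a continuous real-valued function. Let Ω be a nonempty subset of D and let f be a c-antiderivative of Ω. Then there exists exactly one continuous function f̃ : closure(Ω) ∩ D → ℝ that is a c-antiderivative of closure(Ω) ∩ D and satisfies f̃|_Ω = f. -/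
open scoped BigOperators

namespace Paper

variable {X Y : Type*}

/-- The ℓ²-product distance `√(d_X(x,u)² + d_Y(y,v)²)` on `X × Y`. -/
noncomputable def dist2 [PseudoMetricSpace X] [PseudoMetricSpace Y] (p q : X × Y) : ℝ :=
  Real.sqrt (dist p.1 q.1 ^ 2 + dist p.2 q.2 ^ 2)

/-- The open ball for the ℓ²-product distance. -/
def ball2 [PseudoMetricSpace X] [PseudoMetricSpace Y] (p : X × Y) (r : ℝ) : Set (X × Y) :=
  {q | dist2 p q < r}

/-- The maximal open ball centered at `p` contained in `Dom c`, i.e. `B_{ρ(p)}(p)` where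
`ρ(p) = sup {r > 0 | B_r(p) ⊆ Dom c}`; note `dist2 p q < ρ(p)` iff there exists `r > 0`
with `B_r(p) ⊆ Dom c` and `dist2 p q < r`. -/
def MaxBall [PseudoMetricSpace X] [PseudoMetricSpace Y]
    (c : X × Y → EReal) (p : X × Y) : Set (X × Y) :=
  {q | ∃ r : ℝ, 0 < r ∧ ball2 p r ⊆ Dom c ∧ dist2 p q < r}

/-- `z` is a ball chain in `G` from `p` to `q`. -/
def IsBallChain [PseudoMetricSpace X] [PseudoMetricSpace Y]
    (c : X × Y → EReal) (G : Set (X × Y)) (p q : X × Y)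
    (N : ℕ) (z : Fin (N + 1) → X × Y) : Prop :=
  (∀ k, z k ∈ G) ∧ z 0 = p ∧ z (Fin.last N) = q ∧
    ∀ k : Fin N, (MaxBall c (z k.castSucc) ∩ MaxBall c (z k.succ) ∩ G).Nonempty

open Filter Topology

lemma IsAntideriv.toReal_sub_le {c : X × Y → EReal} (hbot : ∀ p, c p ≠ ⊥)
    {Ω : Set (X × Y)} (hΩD : Ω ⊆ Dom c) {f : X × Y → ℝ} (hf : IsAntideriv c Ω f)
    {p q : X × Y} (hp : p ∈ Ω) (hq : q ∈ Ω) (h : (q.1, p.2) ∈ Dom c) :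
    (c p).toReal - (c (q.1, p.2)).toReal ≤ f p - f q := by
  have h1 := hf p hp q hq
  rw [← EReal.coe_toReal (hΩD hp).ne (hbot p), ← EReal.coe_toReal h.ne (hbot _)] at h1
  exact_mod_cast h1

lemma tendsto_toReal_sub_cross [TopologicalSpace X] [TopologicalSpace Y]
    {c : X × Y → EReal} (hD : IsOpen (Dom c))
    (hcont : ContinuousOn (fun p => (c p).toReal) (Dom c))
    {p q : X × Y} (hp : p ∈ Dom c) (h : (q.1, p.2) ∈ Dom c) :
    Tendsto (fun z : (X × Y) × (X × Y) => (c z.1).toReal - (c (z.2.1, z.1.2)).toReal)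
      (𝓝 (p, q)) (𝓝 ((c p).toReal - (c (q.1, p.2)).toReal)) := by
  have h1 := (hcont.continuousAt (hD.mem_nhds hp)).tendsto
  have h2 := (hcont.continuousAt (hD.mem_nhds h)).tendsto
  have e1 : Tendsto (fun z : (X × Y) × (X × Y) => z.1) (𝓝 (p, q)) (𝓝 p) :=
    continuous_fst.tendsto (p, q)
  have e2 : Tendsto (fun z : (X × Y) × (X × Y) => (z.2.1, z.1.2)) (𝓝 (p, q))
      (𝓝 (q.1, p.2)) :=
    Continuous.tendsto (f := fun z : (X × Y) × (X × Y) => (z.2.1, z.1.2))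
      (by fun_prop) (p, q)
  exact (h1.comp e1).sub (h2.comp e2)

lemma IsAntideriv.eventually_toReal_sub_le [TopologicalSpace X] [TopologicalSpace Y]
    {c : X × Y → EReal} (hbot : ∀ p, c p ≠ ⊥) (hD : IsOpen (Dom c))
    {Ω : Set (X × Y)} (hΩD : Ω ⊆ Dom c) {f : X × Y → ℝ} (hf : IsAntideriv c Ω f)
    {p q : X × Y} (h : (q.1, p.2) ∈ Dom c) :
    ∀ᶠ z : (X × Y) × (X × Y) in 𝓝[Ω] p ×ˢ 𝓝[Ω] q,
      (c z.1).toReal - (c (z.2.1, z.1.2)).toReal ≤ f z.1 - f z.2 := by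
  have hle : 𝓝[Ω] p ×ˢ 𝓝[Ω] q ≤ 𝓝 (p, q) := by
    rw [nhds_prod_eq]; exact prod_mono nhdsWithin_le_nhds nhdsWithin_le_nhds
  have hcross : ∀ᶠ z : (X × Y) × (X × Y) in 𝓝 (p, q), (z.2.1, z.1.2) ∈ Dom c :=
    Continuous.tendsto (f := fun z : (X × Y) × (X × Y) => (z.2.1, z.1.2))
      (by fun_prop) (p, q) (hD.mem_nhds h)
  have hmem : ∀ᶠ z : (X × Y) × (X × Y) in 𝓝[Ω] p ×ˢ 𝓝[Ω] q, z.1 ∈ Ω ∧ z.2 ∈ Ω :=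
    prod_mem_prod self_mem_nhdsWithin self_mem_nhdsWithin
  filter_upwards [hle hcross, hmem] with z hz hzΩ
  exact hf.toReal_sub_le hbot hΩD hzΩ.1 hzΩ.2 hz

lemma IsAntideriv.exists_tendsto [TopologicalSpace X] [TopologicalSpace Y]
    {c : X × Y → EReal} (hbot : ∀ p, c p ≠ ⊥) (hD : IsOpen (Dom c))
    (hcont : ContinuousOn (fun p => (c p).toReal) (Dom c))
    {Ω : Set (X × Y)} (hΩD : Ω ⊆ Dom c) {f : X × Y → ℝ} (hf : IsAntideriv c Ω f)
    {r : X × Y} (hr : r ∈ closure Ω ∩ Dom c) :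
    ∃ y, Tendsto f (𝓝[Ω] r) (𝓝 y) := by
  have : (𝓝[Ω] r).NeBot := mem_closure_iff_nhdsWithin_neBot.mp hr.1
  suffices Cauchy (map f (𝓝[Ω] r)) from CompleteSpace.complete this
  have hle : 𝓝[Ω] r ×ˢ 𝓝[Ω] r ≤ 𝓝 (r, r) := by
    rw [nhds_prod_eq]; exact prod_mono nhdsWithin_le_nhds nhdsWithin_le_nhds
  have hlow := (tendsto_toReal_sub_cross (q := r) hD hcont hr.2 hr.2).mono_left hle
  have hev := hf.eventually_toReal_sub_le hbot hD hΩD (p := r) (q := r) hr.2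
  have hswap : Tendsto Prod.swap (𝓝[Ω] r ×ˢ 𝓝[Ω] r) (𝓝[Ω] r ×ˢ 𝓝[Ω] r) :=
    tendsto_snd.prodMk tendsto_fst
  have hhigh := (hlow.comp hswap).neg
  have hev' := hswap.eventually hev
  simp only [Prod.mk.eta, sub_self, neg_zero] at hlow hhigh
  have hlim : Tendsto (fun z : (X × Y) × (X × Y) => f z.1 - f z.2)
      (𝓝[Ω] r ×ˢ 𝓝[Ω] r) (𝓝 0) := by
    refine tendsto_of_tendsto_of_tendsto_of_le_of_le' hlow hhigh hev ?_
    filter_upwards [hev'] with z hz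
    simp only [Function.comp_apply, Prod.fst_swap, Prod.snd_swap] at hz ⊢
    linarith
  rw [cauchy_map_iff]
  refine ⟨this, ?_⟩
  rw [tendsto_uniformity_iff_dist_tendsto_zero]
  simpa [Real.dist_eq] using hlim.abs

lemma IsAntideriv.extendFrom [TopologicalSpace X] [TopologicalSpace Y]
    {c : X × Y → EReal} (hbot : ∀ p, c p ≠ ⊥) (hD : IsOpen (Dom c))
    (hcont : ContinuousOn (fun p => (c p).toReal) (Dom c))
    {Ω : Set (X × Y)} (hΩD : Ω ⊆ Dom c) {f : X × Y → ℝ} (hf : IsAntideriv c Ω f) :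
    IsAntideriv c (closure Ω ∩ Dom c) (extendFrom Ω f) := by
  intro p hp q hq
  by_cases h : (q.1, p.2) ∈ Dom c
  · have : (𝓝[Ω] p).NeBot := mem_closure_iff_nhdsWithin_neBot.mp hp.1
    have : (𝓝[Ω] q).NeBot := mem_closure_iff_nhdsWithin_neBot.mp hq.1
    have hle : 𝓝[Ω] p ×ˢ 𝓝[Ω] q ≤ 𝓝 (p, q) := by
      rw [nhds_prod_eq]; exact prod_mono nhdsWithin_le_nhds nhdsWithin_le_nhds
    have hp' := tendsto_extendFrom (hf.exists_tendsto hbot hD hcont hΩD hp)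
    have hq' := tendsto_extendFrom (hf.exists_tendsto hbot hD hcont hΩD hq)
    have key := le_of_tendsto_of_tendsto
      ((tendsto_toReal_sub_cross hD hcont hp.2 h).mono_left hle)
      ((hp'.comp tendsto_fst).sub (hq'.comp tendsto_snd))
      (hf.eventually_toReal_sub_le hbot hD hΩD h)
    rw [← EReal.coe_toReal hp.2.ne (hbot p), ← EReal.coe_toReal h.ne (hbot _)]
    exact_mod_cast key
  · have htop : c (q.1, p.2) = ⊤ := not_lt_top_iff.mp h
    rw [htop, EReal.sub_top]
    exact bot_le

/-- if the domain of `c` is open and `c` is continuous (real-valued) on it,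
then a `c`-antiderivative `f` of `Ω ⊆ Dom c` extends uniquely to a continuous
`c`-antiderivative of `closure Ω ∩ Dom c`. -/
theorem unique_continuous_extension [MetricSpace X] [MetricSpace Y]
    (c : X × Y → EReal) (hbot : ∀ p, c p ≠ ⊥) (hD : IsOpen (Dom c))
    (hcont : ContinuousOn (fun p => (c p).toReal) (Dom c))
    (Ω : Set (X × Y)) (hΩne : Ω.Nonempty) (hΩD : Ω ⊆ Dom c)
    (f : X × Y → ℝ) (hf : IsAntideriv c Ω f) :
    ∃! g : (closure Ω ∩ Dom c : Set (X × Y)) → ℝ,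
      Continuous g ∧
      (∀ p q : (closure Ω ∩ Dom c : Set (X × Y)),
        c p.1 - c ((q.1).1, (p.1).2) ≤ (g p : EReal) - (g q : EReal)) ∧
      (∀ p : (closure Ω ∩ Dom c : Set (X × Y)), (p : X × Y) ∈ Ω → g p = f p) := by
  have hlim : ∀ p ∈ closure Ω ∩ Dom c, ∃ y, Tendsto f (𝓝[Ω] p) (𝓝 y) :=
    fun p hp => hf.exists_tendsto hbot hD hcont hΩD hp
  have heq : ∀ p ∈ Ω, extendFrom Ω f p = f p := by
    intro p hp
    have h := tendsto_extendFrom (hlim p ⟨subset_closure hp, hΩD hp⟩)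
    exact tendsto_nhds_unique (h.mono_left (pure_le_nhdsWithin hp))
      (tendsto_pure_nhds f p)
  refine ⟨fun p => extendFrom Ω f p,
    ⟨?_, fun p q => hf.extendFrom hbot hD hcont hΩD p p.2 q q.2, fun p hp => heq p hp⟩, ?_⟩
  · exact (continuousOn_extendFrom Set.inter_subset_left hlim).domRestrict
  · rintro g ⟨hg, -, hgf⟩
    have hdense : Dense {p : (closure Ω ∩ Dom c : Set (X × Y)) | (p : X × Y) ∈ Ω} := by
      rw [Subtype.dense_iff]
      intro p hp
      refine closure_mono (s := Ω) ?_ hp.1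
      exact fun x hx => ⟨⟨x, subset_closure hx, hΩD hx⟩, hx, rfl⟩
    exact hg.ext_on hdense
      (continuousOn_extendFrom Set.inter_subset_left hlim).domRestrict
      fun p hp => (hgf p hp).trans (heq p hp).symm

end Paper
end

section
/- Let c : ℝ × ℝ → ℝ ∪ {+∞} be a cost function that is ⊖-monotone and whose domain D is convex. Then a nonempty subset G of D is c-cyclically monotone if and only if G is a ≼⊖-chain. -/
open scoped BigOperators

namespace Paper

variable {X Y : Type*}

/-- The order `(x,y) ≼⊖ (u,v) ⟺ x ≤ u ∧ y ≥ v` on `ℝ × ℝ`. -/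
def leOminus (p q : ℝ × ℝ) : Prop := p.1 ≤ q.1 ∧ q.2 ≤ p.2

/-- `S` is a `≼⊖`-chain. -/
def OminusChain (S : Set (ℝ × ℝ)) : Prop :=
  ∀ p ∈ S, ∀ q ∈ S, leOminus p q ∨ leOminus q p

/-- The cost `c` is `⊖`-monotone. -/
def OminusMonotone (c : ℝ × ℝ → EReal) : Prop :=
  ∀ p q : ℝ × ℝ, p ∈ Dom c → q ∈ Dom c →
    c p - c (q.1, p.2) + (c q - c (p.1, q.2)) ≤ 0 →
    (leOminus p q ∨ leOminus q p)

/-- A `⊖`-monotone cost is strictly supermodular along strictly increasing pairs of its domain, and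
the domain contains the two opposite corners of such a pair. -/
theorem OminusMonotone.lt_of_lt {c : ℝ × ℝ → EReal} (hbot : ∀ p, c p ≠ ⊥)
    (hmono : OminusMonotone c) {a b u v : ℝ} (hau : c (a, u) < ⊤) (hbv : c (b, v) < ⊤)
    (hab : a < b) (huv : u < v) :
    c (b, u) < ⊤ ∧ c (a, v) < ⊤ ∧
      (c (b, u)).toReal + (c (a, v)).toReal < (c (a, u)).toReal + (c (b, v)).toReal := by
  have hcross : ¬ c (a, u) - c (b, u) + (c (b, v) - c (a, v)) ≤ 0 := by
    intro h
    rcases hmono (a, u) (b, v) hau hbv h with h | h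
    · exact absurd h.2 (not_le.2 huv)
    · exact absurd h.1 (not_le.2 hab)
  have hbu : c (b, u) < ⊤ := by
    refine lt_top_iff_ne_top.2 fun h => hcross ?_
    simp [h, sub_eq_add_neg]
  have hav : c (a, v) < ⊤ := by
    refine lt_top_iff_ne_top.2 fun h => hcross ?_
    simp [h, sub_eq_add_neg]
  refine ⟨hbu, hav, ?_⟩
  rw [← EReal.coe_toReal hau.ne (hbot _), ← EReal.coe_toReal hbv.ne (hbot _),
    ← EReal.coe_toReal hbu.ne (hbot _), ← EReal.coe_toReal hav.ne (hbot _)] at hcross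
  norm_cast at hcross
  linarith

/-- Weak form of `OminusMonotone.lt_of_lt`, allowing equal coordinates. -/
theorem OminusMonotone.le_of_le {c : ℝ × ℝ → EReal} (hbot : ∀ p, c p ≠ ⊥)
    (hmono : OminusMonotone c) {a b u v : ℝ} (hau : c (a, u) < ⊤) (hbv : c (b, v) < ⊤)
    (hab : a ≤ b) (huv : u ≤ v) :
    c (b, u) < ⊤ ∧
      (c (b, u)).toReal + (c (a, v)).toReal ≤ (c (a, u)).toReal + (c (b, v)).toReal := by
  rcases hab.eq_or_lt with rfl | hab
  · exact ⟨hau, le_rfl⟩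
  rcases huv.eq_or_lt with rfl | huv
  · exact ⟨hbv, (add_comm _ _).le⟩
  obtain ⟨h, -, hlt⟩ := hmono.lt_of_lt hbot hau hbv hab huv
  exact ⟨h, hlt.le⟩

/-- Rearrangement inequality: among all finite-cost rearrangements of a finite family forming a
`≼⊖`-chain, the identity has the smallest cost. -/
theorem OminusMonotone.sum_le_sum_perm {c : ℝ × ℝ → EReal} (hbot : ∀ p, c p ≠ ⊥)
    (hmono : OminusMonotone c) {ι : Type*} [Fintype ι] (w : ι → ℝ × ℝ)
    (hchain : ∀ i j, leOminus (w i) (w j) ∨ leOminus (w j) (w i))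
    (hw : ∀ i, c (w i) < ⊤) (σ : Equiv.Perm ι) (hσ : ∀ i, c ((w (σ i)).1, (w i).2) < ⊤) :
    ∑ i, (c (w i)).toReal ≤ ∑ i, (c ((w (σ i)).1, (w i).2)).toReal := by
  classical
  suffices H : ∀ (s : Finset ι) (σ : Equiv.Perm ι), (∀ i, i ∉ s → σ i = i) →
      (∀ i, c ((w (σ i)).1, (w i).2) < ⊤) →
      ∑ i, (c (w i)).toReal ≤ ∑ i, (c ((w (σ i)).1, (w i).2)).toReal from
    H Finset.univ σ (fun i hi => absurd (Finset.mem_univ i) hi) hσ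
  intro s
  induction s using Finset.induction_on_max_value (fun i => (w i).2 - (w i).1) with
  | empty =>
    intro σ hfix _
    exact (Finset.sum_congr rfl fun i _ => by rw [hfix i (Finset.notMem_empty i)]).le
  | insert m s hms hmax ih =>
    intro σ hfix hσ
    have hleast : ∀ i ∈ insert m s, (w m).1 ≤ (w i).1 ∧ (w i).2 ≤ (w m).2 := by
      intro i hi
      rcases Finset.mem_insert.1 hi with rfl | hi
      · exact ⟨le_rfl, le_rfl⟩
      · have := hmax i hi
        rcases hchain m i with h | h
        · exact h
        · exact ⟨by linarith [h.1, h.2], by linarith [h.1, h.2]⟩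
    obtain ⟨j, hj⟩ := σ.surjective m
    by_cases hjm : j = m
    · subst hjm
      refine ih σ (fun i hi => ?_) hσ
      by_cases hij : i = j
      · rw [hij, hj]
      · exact hfix i (by simp [hij, hi])
    have hσm : σ m ≠ m := fun h => hjm (σ.injective (hj.trans h.symm))
    have hjs : j ∈ insert m s := by
      by_contra h
      exact hjm ((hfix j h).symm.trans hj)
    have hσms : σ m ∈ insert m s := by
      by_contra h
      exact hσm (σ.injective (hfix _ h))
    have h₁ := hσ j
    rw [hj] at h₁
    obtain ⟨hfin, hle⟩ := hmono.le_of_le hbot h₁ (hσ m) (hleast _ hσms).1 (hleast _ hjs).2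
    set τ : Equiv.Perm ι := σ * Equiv.swap m j with hτ
    have hτm : τ m = m := by simp [hτ, hj]
    have hτj : τ j = σ m := by simp [hτ]
    have hτi : ∀ i, i ≠ m → i ≠ j → τ i = σ i := fun i h h' => by
      simp [hτ, Equiv.swap_apply_of_ne_of_ne h h']
    refine (ih τ (fun i hi => ?_) fun i => ?_).trans ?_
    · by_cases him : i = m
      · rw [him, hτm]
      · have hi' : i ∉ insert m s := by simp [him, hi]
        rw [hτi i him fun h => hi' (h ▸ hjs), hfix i hi']
    · by_cases him : i = m
      · rw [him, hτm]
        exact hw m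
      · by_cases hij : i = j
        · rw [hij, hτj]
          exact hfin
        · rw [hτi i him hij]
          exact hσ i
    · have hjmem : j ∈ Finset.univ.erase m := by simp [hjm]
      rw [← Finset.add_sum_erase _ _ (Finset.mem_univ m), ← Finset.add_sum_erase _ _ hjmem,
        ← Finset.add_sum_erase (Finset.univ : Finset ι)
          (fun i => (c ((w (σ i)).1, (w i).2)).toReal) (Finset.mem_univ m),
        ← Finset.add_sum_erase _ (fun i => (c ((w (σ i)).1, (w i).2)).toReal) hjmem]
      have hrest : ∑ i ∈ (Finset.univ.erase m).erase j, (c ((w (τ i)).1, (w i).2)).toReal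
          = ∑ i ∈ (Finset.univ.erase m).erase j, (c ((w (σ i)).1, (w i).2)).toReal := by
        refine Finset.sum_congr rfl fun i hi => ?_
        simp only [Finset.mem_erase] at hi
        rw [hτi i hi.2.1 hi.1]
      rw [hrest, hτm, hτj, hj]
      linarith

/-- Cycles inside a `≼⊖`-chain have nonpositive inner variation. -/
theorem OminusMonotone.pathSum_nonpos {c : ℝ × ℝ → EReal} (hbot : ∀ p, c p ≠ ⊥)
    (hmono : OminusMonotone c) {G : Set (ℝ × ℝ)} (hGD : G ⊆ Dom c) (hchain : OminusChain G)
    {p : ℝ × ℝ} {N : ℕ} {z : Fin (N + 1) → ℝ × ℝ} (hz : IsPath c G p p N z) :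
    pathSum c z ≤ 0 := by
  obtain ⟨hzG, hz0, hzl, hzfin⟩ := hz
  cases N with
  | zero => simp [pathSum]
  | succ n =>
    have hrot : ∀ k : Fin (n + 1), z k.succ = z (finRotate (n + 1) k).castSucc := by
      intro k
      induction k using Fin.lastCases with
      | last => simp [hz0, hzl]
      | cast i =>
        congr 1
        ext
        simp
    have h := hmono.sum_le_sum_perm hbot (fun k : Fin (n + 1) => z k.castSucc)
      (fun i j => hchain _ (hzG _) _ (hzG _)) (fun i => hGD (hzG _)) (finRotate (n + 1))
      (fun i => hrot i ▸ hzfin i)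
    simp only [← hrot] at h
    rw [pathSum, Finset.sum_sub_distrib]
    linarith

/-- for a `⊖`-monotone cost with convex domain, a nonempty subset of the
domain is `c`-cyclically monotone iff it is a `≼⊖`-chain. -/
theorem cyclicallyMonotone_iff_ominusChain (c : ℝ × ℝ → EReal) (hbot : ∀ p, c p ≠ ⊥)
    (hmono : OminusMonotone c) (hconv : Convex ℝ (Dom c))
    (G : Set (ℝ × ℝ)) (hne : G.Nonempty) (hGD : G ⊆ Dom c) :
    CyclicallyMonotone c G ↔ OminusChain G := by
  constructor
  · intro hG
    have hle : ∀ p ∈ G, ∀ q ∈ G, p.1 < q.1 → q.2 ≤ p.2 := by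
      intro p hp q hq h₁
      by_contra! h₂
      obtain ⟨hqp, hpq, hlt⟩ := hmono.lt_of_lt hbot (hGD hp) (hGD hq) h₁ h₂
      have hpath : IsPath c G p p 2 ![p, q, p] := by
        refine ⟨fun k => ?_, rfl, rfl, fun k => ?_⟩
        · fin_cases k
          exacts [hp, hq, hp]
        · fin_cases k
          exacts [hqp, hpq]
      have hsum : ((pathSum c ![p, q, p] : ℝ) : EReal) ≤ 0 :=
        sSup_le_iff.1 (hG p hp) _ ⟨2, ![p, q, p], hpath, rfl⟩
      have hsum' : pathSum c ![p, q, p] ≤ 0 := by exact_mod_cast hsum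
      simp [pathSum, Fin.sum_univ_two] at hsum'
      linarith
    intro p hp q hq
    rcases lt_trichotomy p.1 q.1 with h | h | h
    · exact Or.inl ⟨h.le, hle p hp q hq h⟩
    · exact (le_total q.2 p.2).imp (fun h' => ⟨h.le, h'⟩) fun h' => ⟨h.ge, h'⟩
    · exact Or.inr ⟨h.le, hle q hq p hp h⟩
  · intro hchain p _
    refine sSup_le ?_
    rintro _ ⟨N, z, hz, rfl⟩
    exact_mod_cast hmono.pathSum_nonpos hbot hGD hchain hz

end Paper
end

section
/- Let c : ℝ × ℝ → ℝ ∪ {+∞} be ⊖-monotone with convex domain D, and let G ⊆ D be a ≼⊖-chain. Let (x_s,y_s), (x_m,y_m), (x_e,y_e) ∈ G be such that (i) c(x_m,y_s) < +∞ and c(x_e,y_m) < +∞, and (ii) it is not the case that min_{≼⊖}{(x_s,y_s),(x_e,y_e)} ≼⊖ (x_m,y_m) ≼⊖ max_{≼⊖}{(x_s,y_s),(x_e,y_e)}, where min and max are taken in the two-element ≼⊖-chain {(x_s,y_s),(x_e,y_e)}. Then c(x_s,y_s) − c(x_m,y_s) + c(x_m,y_m) − c(x_e,y_m) ≤ c(x_s,y_s)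 − c(x_e,y_s), interpreted in [−∞,+∞]. -/
open scoped BigOperators

namespace Paper

variable {X Y : Type*}

/-- If two points of the domain are in strictly increasing position, the other two corners of the
rectangle they span lie in the domain and have strictly smaller total cost. -/
theorem OminusMonotone.lt_of_lt_s17 {c : ℝ × ℝ → EReal} (hbot : ∀ p, c p ≠ ⊥)
    (hmono : OminusMonotone c) {x u y v : ℝ} (hp : c (x, y) < ⊤) (hq : c (u, v) < ⊤)
    (hx : x < u) (hy : y < v) :
    c (u, y) < ⊤ ∧ c (x, v) < ⊤ ∧
      (c (u, y)).toReal + (c (x, v)).toReal < (c (x, y)).toReal + (c (u, v)).toReal := by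
  have h : ¬ (c (x, y) - c (u, y) + (c (u, v) - c (x, v)) ≤ 0) := fun h => by
    rcases hmono (x, y) (u, v) hp hq h with h | h
    · exact absurd h.2 (not_le.2 hy)
    · exact absurd h.1 (not_le.2 hx)
  have h1 : c (u, y) ≠ ⊤ := fun h1 => h (by simp [h1])
  have h2 : c (x, v) ≠ ⊤ := fun h2 => h (by simp [h2])
  refine ⟨h1.lt_top, h2.lt_top, ?_⟩
  rw [← EReal.coe_toReal hp.ne (hbot _), ← EReal.coe_toReal hq.ne (hbot _),
    ← EReal.coe_toReal h1 (hbot _), ← EReal.coe_toReal h2 (hbot _)] at h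
  norm_cast at h
  linarith

/-- the three-point inequality for a `⊖`-monotone cost with convex domain
on a `≼⊖`-chain, when the middle point is not `≼⊖`-between the endpoints. -/
theorem three_point_inequality (c : ℝ × ℝ → EReal) (hbot : ∀ p, c p ≠ ⊥)
    (hmono : OminusMonotone c) (hconv : Convex ℝ (Dom c))
    (G : Set (ℝ × ℝ)) (hGD : G ⊆ Dom c) (hchain : OminusChain G)
    (ps pm pe : ℝ × ℝ) (hps : ps ∈ G) (hpm : pm ∈ G) (hpe : pe ∈ G)
    (h1 : c (pm.1, ps.2) < ⊤) (h2 : c (pe.1, pm.2) < ⊤)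
    (hmid : ¬ ((leOminus ps pe ∧ leOminus ps pm ∧ leOminus pm pe) ∨
               (leOminus pe ps ∧ leOminus pe pm ∧ leOminus pm ps))) :
    c ps - c (pm.1, ps.2) + (c pm - c (pe.1, pm.2)) ≤ c ps - c (pe.1, ps.2) := by
  obtain ⟨xs, ys⟩ := ps
  obtain ⟨xm, ym⟩ := pm
  obtain ⟨xe, ye⟩ := pe
  have hs : c (xs, ys) < ⊤ := hGD hps
  have hm : c (xm, ym) < ⊤ := hGD hpm
  have hsm := hchain _ hps _ hpm
  have hme := hchain _ hpm _ hpe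
  simp only [leOminus] at h1 h2 hmid hsm hme ⊢
  have key : c (xe, ys) < ⊤ ∧
      (c (xm, ym)).toReal + (c (xe, ys)).toReal ≤
        (c (xe, ym)).toReal + (c (xm, ys)).toReal := by
    rcases lt_trichotomy xe xm with hx | rfl | hx
    · rcases lt_trichotomy ym ys with hy | rfl | hy
      · obtain ⟨-, h, hlt⟩ := hmono.lt_of_lt_s17 hbot h2 h1 hx hy
        exact ⟨h, hlt.le⟩
      · exact ⟨h2, by linarith⟩
      · grind
    · exact ⟨h1, le_rfl⟩
    · rcases lt_trichotomy ym ys with hy | rfl | hy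
      · grind
      · exact ⟨h2, by linarith⟩
      · obtain ⟨h, -, hlt⟩ := hmono.lt_of_lt_s17 hbot h1 h2 hx hy
        exact ⟨h, by linarith⟩
  obtain ⟨h3, hle⟩ := key
  rw [← EReal.coe_toReal hs.ne (hbot _), ← EReal.coe_toReal hm.ne (hbot _),
    ← EReal.coe_toReal h1.ne (hbot _), ← EReal.coe_toReal h2.ne (hbot _),
    ← EReal.coe_toReal h3.ne (hbot _)]
  norm_cast
  linarith

end Paper
end

section
/- Let c : ℝ × ℝ → ℝ ∪ {+∞} be ⊖-monotone with convex domain D, and let G ⊆ D be a nonempty ≼⊖-chain. Let ((x_i,y_i))_{i=1}^{N+1} be a finite sequence in G with N ≥ 2 such that for every 2 ≤ j ≤ N it is not the case that min_{≼⊖}{(x_1,y_1),(x_{N+1},y_{N+1})} ≼⊖ (x_j,y_j) ≼⊖ max_{≼⊖}{(x_1,y_1),(x_{N+1},y_{N+1})}, where min and max are taken in the two-element ≼⊖-chain {(x_1,y_1),(x_{N+1},y_{N+1})}. Then ∑_{i=1}^{N} (c(x_i,y_i) − c(x_{i+1},y_i)) ≤ c(x_1,y_1) − c(x_{N+1},y_1),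 interpreted in [−∞,+∞]. -/
open scoped BigOperators

namespace Paper

variable {X Y : Type*}

/-- One step `c(x,y) − c(u,y)` of the inner variation, from `p = (x,y)` to `q = (u,v)`. -/
noncomputable def stepVar (c : X × Y → EReal) (p q : X × Y) : EReal :=
  c p - c (q.1, p.2)

/-- A strictly increasing pair of points of the domain satisfies the strict
supermodularity inequality; in particular the opposite corner lies in the domain. -/
lemma OminusMonotone.lt_of_lt_of_lt {c : ℝ × ℝ → EReal} (hmono : OminusMonotone c)
    {p q : ℝ × ℝ} (hp : p ∈ Dom c) (hq : q ∈ Dom c)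
    (h : (p.1 < q.1 ∧ p.2 < q.2) ∨ (q.1 < p.1 ∧ q.2 < p.2)) :
    0 < c p - c (q.1, p.2) + (c q - c (p.1, q.2)) := by
  by_contra hle
  have := hmono p q hp hq (not_lt.mp hle)
  simp only [leOminus] at this
  grind

/-- The three-point inequality: a step through `q` may be shortcut when `(q.1, p.2)` and
`(r.1, q.2)` are weakly increasing in one order or the other. -/
lemma stepVar_add_le {c : ℝ × ℝ → EReal} (hbot : ∀ p, c p ≠ ⊥) (hmono : OminusMonotone c)
    {p q r : ℝ × ℝ} (hp : p ∈ Dom c) (hq : q ∈ Dom c)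
    (h : (q.1 ≤ r.1 ∧ p.2 ≤ q.2) ∨ (r.1 ≤ q.1 ∧ q.2 ≤ p.2)) :
    stepVar c p q + stepVar c q r ≤ stepVar c p r := by
  obtain ⟨px, py⟩ := p
  obtain ⟨qx, qy⟩ := q
  obtain ⟨rx, ry⟩ := r
  simp only [stepVar, Dom, Set.mem_ofPred_eq] at *
  lift c (px, py) to ℝ using ⟨hp.ne, hbot _⟩ with a
  by_cases hqp : c (qx, py) = ⊤
  · simp [hqp]
  by_cases hrq : c (rx, qy) = ⊤
  · simp [hrq]
  by_cases hx : qx = rx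
  · subst hx
    rw [EReal.sub_self hq.ne (hbot _), add_zero]
  by_cases hy : py = qy
  · subst hy
    lift c (qx, py) to ℝ using ⟨hqp, hbot _⟩ with d
    lift c (rx, py) to ℝ using ⟨hrq, hbot _⟩ with e
    norm_cast
    linarith
  have key := hmono.lt_of_lt_of_lt (p := (qx, py)) (q := (rx, qy))
    (lt_top_iff_ne_top.mpr hqp) (lt_top_iff_ne_top.mpr hrq) (by grind)
  simp only at key
  have hrp : c (rx, py) ≠ ⊤ := by
    intro htop
    simp [htop] at key
  have hbrp := hbot (rx, py)
  lift c (qx, qy) to ℝ using ⟨hq.ne, hbot _⟩ with b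
  lift c (qx, py) to ℝ using ⟨hqp, hbot _⟩ with d
  lift c (rx, qy) to ℝ using ⟨hrq, hbot _⟩ with e
  lift c (rx, py) to ℝ using ⟨hrp, hbrp⟩ with g
  norm_cast at key ⊢
  linarith

/-- On a `≼⊖`-chain the order is detected by `(x,y) ↦ x − y`. -/
lemma OminusChain.leOminus_of_sub_le {G : Set (ℝ × ℝ)} (hchain : OminusChain G)
    {p q : ℝ × ℝ} (hp : p ∈ G) (hq : q ∈ G) (h : p.1 - p.2 ≤ q.1 - q.2) :
    leOminus p q := by
  rcases hchain p hp q hq with h' | h'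
  · exact h'
  · obtain ⟨h₁, h₂⟩ := h'
    exact ⟨by linarith, by linarith⟩

/-- A finite sequence with an interior value outside the range spanned by its two
endpoint values has an interior local extremum. -/
lemma exists_local_extremum {α : Type*} [LinearOrder α] (n : ℕ) (f : ℕ → α) {j : ℕ}
    (hj : j ≤ n)
    (h : (f 0 < f j ∧ f n < f j) ∨ (f j < f 0 ∧ f j < f n)) :
    ∃ a, a + 2 ≤ n ∧ ((f a ≤ f (a + 1) ∧ f (a + 2) ≤ f (a + 1)) ∨
      (f (a + 1) ≤ f a ∧ f (a + 1) ≤ f (a + 2))) := by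
  have hmem : ∀ i, i ∈ Finset.range (n + 1) ↔ i ≤ n := by simp
  rcases h with ⟨h₀, h₁⟩ | ⟨h₀, h₁⟩
  · obtain ⟨m, hm, hmax⟩ :=
      Finset.exists_max_image (Finset.range (n + 1)) f ⟨j, (hmem j).mpr hj⟩
    simp only [hmem] at hm hmax
    have hjm := hmax j hj
    have hm0 : m ≠ 0 := by rintro rfl; exact absurd h₀ (not_lt.mpr hjm)
    have hmn : m ≠ n := by rintro rfl; exact absurd h₁ (not_lt.mpr hjm)
    obtain ⟨a, rfl⟩ := Nat.exists_eq_succ_of_ne_zero hm0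
    exact ⟨a, by omega, Or.inl ⟨hmax _ (by omega), hmax _ (by omega)⟩⟩
  · obtain ⟨m, hm, hmin⟩ :=
      Finset.exists_min_image (Finset.range (n + 1)) f ⟨j, (hmem j).mpr hj⟩
    simp only [hmem] at hm hmin
    have hjm := hmin j hj
    have hm0 : m ≠ 0 := by rintro rfl; exact absurd h₀ (not_lt.mpr hjm)
    have hmn : m ≠ n := by rintro rfl; exact absurd h₁ (not_lt.mpr hjm)
    obtain ⟨a, rfl⟩ := Nat.exists_eq_succ_of_ne_zero hm0
    exact ⟨a, by omega, Or.inr ⟨hmin _ (by omega), hmin _ (by omega)⟩⟩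

/-- Deleting the entry `a + 1` of a sequence does not decrease the sum of a step function
that satisfies the triangle inequality at that entry. -/
lemma sum_range_le_sum_range_skip {α : Type*} (s : α → α → EReal) (z : ℕ → α) {a n : ℕ}
    (ha : a + 2 ≤ n + 1)
    (h : s (z a) (z (a + 1)) + s (z (a + 1)) (z (a + 2)) ≤ s (z a) (z (a + 2))) :
    ∑ i ∈ Finset.range (n + 1), s (z i) (z (i + 1)) ≤
      ∑ i ∈ Finset.range n, s (z (if i ≤ a then i else i + 1))
        (z (if i + 1 ≤ a then i + 1 else i + 1 + 1)) := by
  obtain ⟨b, rfl⟩ : ∃ b, n = a + 1 + b := ⟨n - (a + 1), by omega⟩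
  rw [show a + 1 + b + 1 = a + 1 + 1 + b by omega, Finset.sum_range_add _ (a + 1 + 1) b,
    Finset.sum_range_add _ (a + 1) b, Finset.sum_range_succ _ (a + 1), Finset.sum_range_succ _ a,
    Finset.sum_range_succ _ a, add_assoc (Finset.sum _ _)]
  refine add_le_add (add_le_add (Finset.sum_le_sum fun i hi => ?_) ?_)
    (Finset.sum_le_sum fun i _ => ?_)
  · have hi' := Finset.mem_range.mp hi
    rw [if_pos (by omega), if_pos (by omega)]
  · rw [if_pos le_rfl, if_neg (by omega)]
    exact h
  · rw [if_neg (by omega), if_neg (by omega), show a + 1 + 1 + i = a + 1 + i + 1 by omega]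

lemma sum_stepVar_le {c : ℝ × ℝ → EReal} (hbot : ∀ p, c p ≠ ⊥) (hmono : OminusMonotone c)
    {G : Set (ℝ × ℝ)} (hGD : G ⊆ Dom c) (hchain : OminusChain G) (n : ℕ) (z : ℕ → ℝ × ℝ)
    (hz : ∀ i ≤ n + 1, z i ∈ G)
    (hmid : ∀ j, 0 < j → j < n + 1 →
      ((z 0).1 - (z 0).2 < (z j).1 - (z j).2 ∧
        (z (n + 1)).1 - (z (n + 1)).2 < (z j).1 - (z j).2) ∨
      ((z j).1 - (z j).2 < (z 0).1 - (z 0).2 ∧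
        (z j).1 - (z j).2 < (z (n + 1)).1 - (z (n + 1)).2)) :
    ∑ i ∈ Finset.range (n + 1), stepVar c (z i) (z (i + 1)) ≤ stepVar c (z 0) (z (n + 1)) := by
  induction n generalizing z with
  | zero => simp
  | succ n ih =>
    obtain ⟨a, ha, hext⟩ := exists_local_extremum (n + 1 + 1) (fun i => (z i).1 - (z i).2)
      (j := 1) (by omega) (hmid 1 (by omega) (by omega))
    have hz0 := hz a (by omega)
    have hz1 := hz (a + 1) (by omega)
    have hz2 := hz (a + 2) (by omega)
    have hstep : stepVar c (z a) (z (a + 1)) + stepVar c (z (a + 1)) (z (a + 2)) ≤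
        stepVar c (z a) (z (a + 2)) := by
      refine stepVar_add_le hbot hmono (hGD hz0) (hGD hz1) ?_
      rcases hext with ⟨h₁, h₂⟩ | ⟨h₁, h₂⟩
      · exact Or.inr ⟨(hchain.leOminus_of_sub_le hz2 hz1 h₂).1,
          (hchain.leOminus_of_sub_le hz0 hz1 h₁).2⟩
      · exact Or.inl ⟨(hchain.leOminus_of_sub_le hz1 hz2 h₂).1,
          (hchain.leOminus_of_sub_le hz1 hz0 h₁).2⟩
    have hlast : ¬ n + 1 ≤ a := by omega
    have hshort := ih (fun i => z (if i ≤ a then i else i + 1))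
      (fun i hi => hz _ (by split_ifs <;> omega))
      (fun j hj hjn => by
        have := hmid (if j ≤ a then j else j + 1) (by split_ifs <;> omega)
          (by split_ifs <;> omega)
        simpa only [Nat.zero_le, if_true, if_neg hlast] using this)
    simp only [Nat.zero_le, if_true, if_neg hlast] at hshort
    exact (sum_range_le_sum_range_skip (stepVar c) z (by omega) hstep).trans hshort

/-- the many-point inequality for a `⊖`-monotone cost with convex domain
on a `≼⊖`-chain, when no interior point of the sequence is `≼⊖`-between the endpoints. -/
theorem many_point_inequality (c : ℝ × ℝ → EReal) (hbot : ∀ p, c p ≠ ⊥)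
    (hmono : OminusMonotone c) (hconv : Convex ℝ (Dom c))
    (G : Set (ℝ × ℝ)) (hne : G.Nonempty) (hGD : G ⊆ Dom c) (hchain : OminusChain G)
    (N : ℕ) (hN : 2 ≤ N) (z : Fin (N + 1) → ℝ × ℝ) (hz : ∀ i, z i ∈ G)
    (hmid : ∀ j : Fin (N + 1), j ≠ 0 → j ≠ Fin.last N →
      ¬ ((leOminus (z 0) (z (Fin.last N)) ∧ leOminus (z 0) (z j) ∧
            leOminus (z j) (z (Fin.last N))) ∨
         (leOminus (z (Fin.last N)) (z 0) ∧ leOminus (z (Fin.last N)) (z j) ∧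
            leOminus (z j) (z 0)))) :
    ∑ k : Fin N, (c (z k.castSucc) - c ((z k.succ).1, (z k.castSucc).2)) ≤
      c (z 0) - c ((z (Fin.last N)).1, (z 0).2) := by
  obtain ⟨n, rfl⟩ : ∃ n, N = n + 1 := ⟨N - 1, by omega⟩
  let w : ℕ → ℝ × ℝ := fun i => z ⟨min i (n + 1), by omega⟩
  have hw : ∀ k : Fin (n + 1 + 1), w k = z k := fun k =>
    congrArg z (Fin.ext (min_eq_left (Nat.lt_succ_iff.mp k.isLt)))
  have hw0 : w 0 = z 0 := hw 0
  have hwlast : w (n + 1) = z (Fin.last (n + 1)) := hw (Fin.last (n + 1))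
  have hcomp : ∀ i j, ((z i).1 - (z i).2 ≤ (z j).1 - (z j).2) → leOminus (z i) (z j) :=
    fun i j => hchain.leOminus_of_sub_le (hz i) (hz j)
  have hsum := sum_stepVar_le hbot hmono hGD hchain n w (fun i _ => hz _) (fun j hj hjn => by
    have hmid_j := hmid ⟨j, by omega⟩ (by simp [Fin.ext_iff]; omega)
      (by simp [Fin.ext_iff]; omega)
    rw [show w j = z ⟨j, by omega⟩ from hw ⟨j, by omega⟩, hw0, hwlast]
    by_contra hcon
    push Not at hcon
    obtain ⟨h₁, h₂⟩ := hcon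
    rcases lt_or_ge ((z 0).1 - (z 0).2)
      ((z ⟨j, by omega⟩).1 - (z ⟨j, by omega⟩).2) with h | h
    · have h' := h₁ h
      exact hmid_j (Or.inl ⟨hcomp _ _ (h.le.trans h'), hcomp _ _ h.le, hcomp _ _ h'⟩)
    · rcases h.lt_or_eq with hlt | heq
      · have h' := h₂ hlt
        exact hmid_j (Or.inr ⟨hcomp _ _ (h'.trans h), hcomp _ _ h', hcomp _ _ h⟩)
      · rcases le_total ((z 0).1 - (z 0).2)
          ((z (Fin.last (n + 1))).1 - (z (Fin.last (n + 1))).2) with h' | h'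
        · exact hmid_j (Or.inl ⟨hcomp _ _ h', hcomp _ _ heq.ge, hcomp _ _ (h.trans h')⟩)
        · exact hmid_j (Or.inr ⟨hcomp _ _ h', hcomp _ _ (h'.trans heq.ge), hcomp _ _ h⟩))
  rw [← Fin.sum_univ_eq_sum_range (fun i => stepVar c (w i) (w (i + 1))), hw0, hwlast] at hsum
  refine le_of_eq_of_le (Finset.sum_congr rfl fun k _ => ?_) hsum
  rw [← Fin.val_succ, hw k.succ, ← Fin.val_castSucc, hw k.castSucc, stepVar]

end Paper
end
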